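/- arXiv:1404.7793 — 3 statements merged into one kernel-verified Lean document; each statement's English description precedes it below -/
import Mathlib

section
/- Let p be a prime, let r and v_1,…,v_r be positive integers, and let G = ⊕_{i=1}^r ℤ/p^{v_i}ℤ. Let n be a positive integer, let x = (x_1,…,x_n) ∈ G^n, and for 1 ≤ i ≤ n let A_i be a nonempty finite subset of ℤ whose elements are pairwise incongruent modulo p; put A = Π_{i=1}^n A_i. For g ∈ G let N_{g,A}(x) = #{(a_1,…,a_n) ∈ A : a_1·x_1 + … + a_n·x_n = g in G}. Then N_{g,A}(x) = 0 or N_{g,A}(x) ≥ m(#A_1,…,#A_n; #A_1 + … + #A_n − Σ_{i=1}^r (p^{v_i}−1)). -/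
/-- The balls-in-bins quantity `m(a₁,…,a_n; N)`: the minimum of `y₁⋯y_n` over all
integer tuples with `1 ≤ y_i ≤ a_i` and `∑ y_i = N` when `n ≤ N ≤ ∑ a_i`; extended by
`1` for `N < n` and by `∏ a_i` for `N > ∑ a_i`. -/
noncomputable def mBB (n : ℕ) (a : Fin n → ℕ) (N : ℤ) : ℕ :=
  if N < (n : ℤ) then 1
  else if (∑ i, (a i : ℤ)) < N then ∏ i, a i
  else sInf {P : ℕ | ∃ y : Fin n → ℕ,
    (∀ i, 1 ≤ y i ∧ y i ≤ a i) ∧ (∑ i, (y i : ℤ)) = N ∧ P = ∏ i, y i}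

/-- Polynomial functions of total degree at most `d` on `ℤⁿ`, with values in the ring `K`. -/
inductive DegLE (K : Type*) [CommRing K] {n : ℕ} : ℕ → ((Fin n → ℤ) → K) → Prop
  | const (d : ℕ) (c : K) : DegLE K d (fun _ => c)
  | add {d : ℕ} {f g : (Fin n → ℤ) → K} :
      DegLE K d f → DegLE K d g → DegLE K d (fun x => f x + g x)
  | coord_mul {d : ℕ} {f : (Fin n → ℤ) → K} (i : Fin n) :
      DegLE K d f → DegLE K (d + 1) (fun x => (x i : K) * f x)

namespace DegLE

variable {K : Type*} [CommRing K] {n : ℕ}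

theorem mono {d e : ℕ} {f : (Fin n → ℤ) → K} (hf : DegLE K d f) (h : d ≤ e) : DegLE K e f := by
  induction hf generalizing e with
  | const d c => exact const e c
  | add _ _ hf hg => exact add (hf h) (hg h)
  | coord_mul i _ hf =>
    obtain ⟨e, rfl⟩ : ∃ k, e = k + 1 := ⟨e - 1, by omega⟩
    exact coord_mul i (hf (by omega))

theorem const_mul {d : ℕ} {f : (Fin n → ℤ) → K} (c : K) (hf : DegLE K d f) :
    DegLE K d (fun x => c * f x) := by
  induction hf with
  | const d c' => exact const d (c * c')
  | add _ _ hf hg => simpa only [mul_add] using add hf hg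
  | coord_mul i _ hf => simpa only [mul_left_comm c] using coord_mul i hf

theorem mul {d e : ℕ} {f g : (Fin n → ℤ) → K} (hf : DegLE K d f) (hg : DegLE K e g) :
    DegLE K (d + e) (fun x => f x * g x) := by
  induction hf with
  | const d c => exact (const_mul c hg).mono (by omega)
  | add _ _ hf hf' => simpa only [add_mul] using add hf hf'
  | @coord_mul d f i _ hf =>
    have := coord_mul i hf
    simp only [← mul_assoc] at this
    exact this.mono (by omega)

theorem sum {ι : Type*} {d : ℕ} (s : Finset ι) {f : ι → (Fin n → ℤ) → K}
    (hf : ∀ i ∈ s, DegLE K d (f i)) : DegLE K d (fun x => ∑ i ∈ s, f i x) := by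
  classical
  induction s using Finset.induction_on with
  | empty => simpa using const d (0 : K)
  | insert a s ha ih =>
    simp only [Finset.sum_insert ha]
    exact add (hf a (by simp)) (ih fun i hi => hf i (by simp [hi]))

theorem prod {ι : Type*} (s : Finset ι) {d : ι → ℕ} {f : ι → (Fin n → ℤ) → K}
    (hf : ∀ i ∈ s, DegLE K (d i) (f i)) :
    DegLE K (∑ i ∈ s, d i) (fun x => ∏ i ∈ s, f i x) := by
  classical
  induction s using Finset.induction_on with
  | empty => simpa using const 0 (1 : K)
  | insert a s ha ih =>
    simp only [Finset.prod_insert ha, Finset.sum_insert ha]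
    exact mul (hf a (by simp)) (ih fun i hi => hf i (by simp [hi]))

theorem coord_pow (i : Fin n) (k : ℕ) : DegLE K k (fun x : Fin n → ℤ => (x i : K) ^ k) := by
  induction k with
  | zero => simpa using const 0 (1 : K)
  | succ k ih => simpa only [pow_succ'] using coord_mul i ih

theorem polynomial_eval (q : Polynomial K) {k : ℕ} (hq : q.natDegree ≤ k) (i : Fin n) :
    DegLE K k (fun x : Fin n → ℤ => q.eval (x i : K)) := by
  simp only [Polynomial.eval_eq_sum_range' (Nat.lt_succ_of_le hq)]
  exact sum _ fun j hj => (const_mul _ (coord_pow i j)).mono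
    (Nat.lt_succ_iff.mp (Finset.mem_range.mp hj))

theorem cons {d : ℕ} {f : (Fin (n + 1) → ℤ) → K} (hf : DegLE K d f) (t : ℤ) :
    DegLE K d (fun x : Fin n → ℤ => f (Fin.cons t x)) := by
  induction hf with
  | const d c => exact const d c
  | add _ _ hf hg => exact add hf hg
  | coord_mul i _ hf =>
    refine Fin.cases ?_ (fun i => ?_) i
    · simpa using (const_mul (t : K) hf).mono (Nat.le_succ _)
    · simpa using coord_mul i hf

/-- Division with remainder by a linear polynomial in the first coordinate. -/
theorem exists_sub_mul {d : ℕ} {f : (Fin (n + 1) → ℤ) → K} (hf : DegLE K d f) (t : ℤ) :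
    DegLE K d (fun x => f (Fin.cons t (Fin.tail x))) ∧
    ∃ g : (Fin (n + 1) → ℤ) → K,
      (∀ x, f x = f (Fin.cons t (Fin.tail x)) + ((x 0 : K) - t) * g x) ∧
      (∀ e, d = e + 1 → DegLE K e g) ∧ (d = 0 → ∀ x, g x = 0) := by
  induction hf with
  | const d c => exact ⟨const d c, fun _ => 0, by simp, fun e _ => const e 0, by simp⟩
  | add _ _ hf hg =>
    obtain ⟨hf, f', h1, h2, h3⟩ := hf
    obtain ⟨hg, g', k1, k2, k3⟩ := hg
    refine ⟨add hf hg, fun x => f' x + g' x, fun x => ?_, fun e he => add (h2 e he) (k2 e he),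
      fun h x => by simp [h3 h, k3 h]⟩
    linear_combination h1 x + k1 x
  | @coord_mul d f i _ hf =>
    obtain ⟨hf, g, h1, h2, h3⟩ := hf
    have hg (i : Fin (n + 1)) : DegLE K d (fun x => (x i : K) * g x) := by
      rcases d with _ | d
      · simpa [h3 rfl] using const 0 (0 : K)
      · exact coord_mul i (h2 d rfl)
    refine Fin.cases ?_ (fun i => ?_) i
    · refine ⟨by simpa using (const_mul (t : K) hf).mono (Nat.le_succ _),
        fun x => f (Fin.cons t (Fin.tail x)) + (x 0 : K) * g x, fun x => ?_, fun e he => ?_,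
        by simp⟩
      · beta_reduce
        rw [Fin.cons_zero]
        linear_combination (x 0 : K) * h1 x
      · obtain rfl : d = e := by omega
        exact add hf (hg 0)
    · refine ⟨by simpa [Fin.tail] using coord_mul i.succ hf,
        fun x => (x i.succ : K) * g x, fun x => ?_, fun e he => ?_, by simp⟩
      · beta_reduce
        rw [Fin.cons_succ, Fin.tail]
        linear_combination (x i.succ : K) * h1 x
      · obtain rfl : d = e := by omega
        exact hg i.succ

/-- The Alon–Füredi bound for the number of non-zeros of a polynomial on a grid. -/
theorem exists_prod_le_card_ne_zero [IsDomain K] [DecidableEq K] {n d : ℕ}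
    {f : (Fin n → ℤ) → K} (hf : DegLE K d f) (A : Fin n → Finset ℤ)
    (hA : ∀ i, Set.InjOn (Int.cast : ℤ → K) (A i))
    (hne : ∃ x ∈ Fintype.piFinset A, f x ≠ 0) :
    ∃ y : Fin n → ℕ, (∀ i, 1 ≤ y i ∧ y i ≤ (A i).card) ∧
      ∑ i, (A i).card ≤ ∑ i, y i + d ∧
      ∏ i, y i ≤ {x ∈ Fintype.piFinset A | f x ≠ 0}.card := by
  induction n generalizing d with
  | zero =>
    obtain ⟨x, hx, hfx⟩ := hne
    refine ⟨fun _ => 1, fun i => i.elim0, by simp, ?_⟩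
    simpa using Finset.card_pos.mpr ⟨x, Finset.mem_filter.mpr ⟨hx, hfx⟩⟩
  | succ n ih =>
    induction hk : (A 0).card generalizing d f A with
    | zero =>
      obtain ⟨x, hx, -⟩ := hne
      have := Fintype.mem_piFinset.mp hx 0
      simp_all
    | succ k ihk =>
      by_cases hz : ∃ t ∈ A 0, ∀ x ∈ Fintype.piFinset (fun i => A (Fin.succ i)),
          f (Fin.cons t x) = 0
      · obtain ⟨t, ht, hzero⟩ := hz
        obtain ⟨-, g, hfg, hg, hg0⟩ := hf.exists_sub_mul t
        have hfg' : ∀ x ∈ Fintype.piFinset A, f x = ((x 0 : K) - t) * g x := by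
          intro x hx
          rw [hfg x, hzero, zero_add]
          exact Fintype.mem_piFinset.mpr fun i => Fintype.mem_piFinset.mp hx i.succ
        obtain ⟨x, hx, hfx⟩ := hne
        rcases d with _ | d
        · exact absurd (by rw [hfg' x hx, hg0 rfl, mul_zero]) hfx
        have hsub : ∀ i, Function.update A 0 ((A 0).erase t) i ⊆ A i := by
          intro i
          rcases eq_or_ne i 0 with rfl | hi
          · simpa using Finset.erase_subset _ _
          · simp [hi]
        have hgx : g x ≠ 0 := fun h => hfx (by rw [hfg' x hx, h, mul_zero])
        have hxt : x 0 ≠ t := fun h => hfx (by rw [hfg' x hx, h, sub_self, zero_mul])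
        obtain ⟨y, hy, hsum, hprod⟩ := ihk (hg d rfl) (Function.update A 0 ((A 0).erase t))
          (fun i => (hA i).mono (by exact_mod_cast hsub i))
          ⟨x, Fintype.mem_piFinset.mpr fun i => by
            rcases eq_or_ne i 0 with rfl | hi
            · simpa [hxt] using Fintype.mem_piFinset.mp hx 0
            · simpa [hi] using Fintype.mem_piFinset.mp hx i, hgx⟩
          (by simp [Finset.card_erase_of_mem ht, hk])
        refine ⟨y, fun i => ⟨(hy i).1, (hy i).2.trans (Finset.card_le_card (hsub i))⟩, ?_,
          hprod.trans (Finset.card_le_card ?_)⟩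
        · simp only [Fin.sum_univ_succ, Function.update_self, Finset.card_erase_of_mem ht, ne_eq,
            Fin.succ_ne_zero, not_false_eq_true, Function.update_of_ne] at hsum ⊢
          omega
        · intro z hz
          obtain ⟨hz, hgz⟩ := Finset.mem_filter.mp hz
          have hzA : z ∈ Fintype.piFinset A :=
            Fintype.mem_piFinset.mpr fun i => hsub i (Fintype.mem_piFinset.mp hz i)
          refine Finset.mem_filter.mpr ⟨hzA, ?_⟩
          rw [hfg' z hzA]
          refine mul_ne_zero (sub_ne_zero.mpr fun h => ?_) hgz
          have := hA 0 (Fintype.mem_piFinset.mp hzA 0) ht h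
          have hz0 := Fintype.mem_piFinset.mp hz 0
          simp [this] at hz0
      · push Not at hz
        have key : ∀ t ∈ A 0, ∃ y : Fin n → ℕ, (∀ i, 1 ≤ y i ∧ y i ≤ (A i.succ).card) ∧
            ∑ i, (A (Fin.succ i)).card ≤ ∑ i, y i + d ∧
            ∏ i, y i ≤ {x ∈ Fintype.piFinset (fun i => A (Fin.succ i)) |
              f (Fin.cons t x) ≠ 0}.card :=
          fun t ht => ih (hf.cons t) (fun i => A i.succ) (fun i => hA _) (hz t ht)
        choose! y hy using key
        obtain ⟨s, hs, hmin⟩ := Finset.exists_min_image (A 0) (fun t => ∏ i, y t i)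
          (Finset.card_pos.mp (by omega))
        refine ⟨Fin.cons (k + 1) (y s), ?_, ?_, ?_⟩
        · refine Fin.cases (by simp [hk]) fun i => ?_
          simpa using (hy s hs).1 i
        · have := (hy s hs).2.1
          simp only [Fin.sum_univ_succ, Fin.cons_zero, Fin.cons_succ]
          omega
        · rw [Finset.card_eq_sum_card_fiberwise (f := fun x : Fin (n + 1) → ℤ => x 0) (t := A 0)
            (fun x hx => Fintype.mem_piFinset.mp (Finset.mem_filter.mp hx).1 0)]
          simp only [Fin.prod_univ_succ, Fin.cons_zero, Fin.cons_succ]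
          rw [← hk, ← smul_eq_mul]
          refine Finset.card_nsmul_le_sum _ _ _ fun t ht =>
            (hmin t ht).trans ((hy t ht).2.2.trans ?_)
          refine Finset.card_le_card_of_injOn (fun x => (Fin.cons t x : Fin (n + 1) → ℤ)) ?_
            (Fin.cons_right_injective (α := fun _ => ℤ) t).injOn
          intro x hx
          obtain ⟨hx, hfx⟩ := Finset.mem_filter.mp hx
          simp only [Finset.coe_filter, Set.mem_ofPred_eq, Finset.mem_filter, Fin.cons_zero,
            and_true]
          refine ⟨Fintype.mem_piFinset.mpr (Fin.cases (by simpa using ht) fun i => ?_), hfx⟩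
          simpa using Fintype.mem_piFinset.mp hx i

end DegLE

/-- Functions that agree on the grid `∏ A i` with a polynomial function of degree at most `d`. -/
def DegLEOn (K : Type*) [CommRing K] {n : ℕ} (A : Fin n → Finset ℤ) (d : ℕ)
    (f : (Fin n → ℤ) → K) : Prop :=
  ∃ f', DegLE K d f' ∧ ∀ x ∈ Fintype.piFinset A, f x = f' x

namespace DegLEOn

theorem choose_coord {p : ℕ} [Fact p.Prime] {n : ℕ} {A : Fin n → Finset ℤ} {i : Fin n}
    (hA : Set.InjOn (Int.cast : ℤ → ZMod p) (A i)) (z : ℤ) (k : ℕ) :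
    DegLEOn (ZMod p) A k (fun x => ((Ring.choose (z * x i) k : ℤ) : ZMod p)) := by
  rcases lt_or_ge k p with hk | hk
  · refine ⟨fun x => ((k.factorial : ZMod p)⁻¹) *
      ∏ j ∈ Finset.range k, ((z : ZMod p) * (x i : ZMod p) + (-(j : ZMod p))), ?_, fun x _ => ?_⟩
    · refine DegLE.const_mul _ ?_
      have := DegLE.prod (K := ZMod p) (Finset.range k) (d := fun _ => 1)
        (f := fun j (x : Fin n → ℤ) => (z : ZMod p) * (x i : ZMod p) + (-(j : ZMod p)))
        fun j _ => .add (.const_mul _ (by simpa using DegLE.coord_pow (K := ZMod p) i 1))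
          (.const 1 _)
      simpa using this
    · have h := Ring.descPochhammer_eq_factorial_smul_choose (z * x i) k
      rw [← Polynomial.eval_eq_smeval, descPochhammer_eval_eq_prod_range] at h
      have hfac : (k.factorial : ZMod p) ≠ 0 := by
        rw [Ne, ZMod.natCast_eq_zero_iff, (Fact.out : p.Prime).dvd_factorial]
        omega
      rw [eq_inv_mul_iff_mul_eq₀ hfac]
      have h' := congrArg (Int.cast : ℤ → ZMod p) h
      push_cast [nsmul_eq_mul] at h'
      rw [← h']
      exact Finset.prod_congr rfl fun j _ => sub_eq_add_neg _ _
  · set q := Lagrange.interpolate (A i) (Int.cast : ℤ → ZMod p)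
      (fun a => ((Ring.choose (z * a) k : ℤ) : ZMod p)) with hq
    refine ⟨fun x => q.eval (x i : ZMod p), DegLE.polynomial_eval q ?_ i, fun x hx => ?_⟩
    · have hcard : (A i).card ≤ p := by
        have := Finset.card_le_card_of_injOn (t := Finset.univ) _ (fun _ _ => by simp) hA
        simpa [ZMod.card] using this
      refine Polynomial.natDegree_le_iff_degree_le.mpr
        ((Lagrange.degree_interpolate_lt _ hA).le.trans ?_)
      exact_mod_cast hcard.trans hk
    · beta_reduce
      rw [hq, Lagrange.eval_interpolate_at_node _ hA (Fintype.mem_piFinset.mp hx i)]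

theorem choose_add_sum {p : ℕ} [Fact p.Prime] {n : ℕ} {A : Fin n → Finset ℤ}
    (hA : ∀ i, Set.InjOn (Int.cast : ℤ → ZMod p) (A i)) (c : ℤ) (z : Fin n → ℤ)
    (s : Finset (Fin n)) (k : ℕ) :
    DegLEOn (ZMod p) A k
      (fun x => ((Ring.choose (c + ∑ i ∈ s, z i * x i) k : ℤ) : ZMod p)) := by
  induction s using Finset.induction_on generalizing k with
  | empty => exact ⟨_, .const k ((Ring.choose c k : ℤ) : ZMod p), by simp⟩
  | insert a s ha ih =>
    choose f hf hfeq using fun k => choose_coord (hA a) (z a) k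
    choose g hg hgeq using ih
    refine ⟨fun x => ∑ ij ∈ Finset.HasAntidiagonal.antidiagonal k, f ij.1 x * g ij.2 x,
      .sum _ fun ij hij => ?_, fun x hx => ?_⟩
    · rw [← Finset.HasAntidiagonal.mem_antidiagonal.mp hij]
      exact (hf _).mul (hg _)
    · beta_reduce at hfeq hgeq ⊢
      rw [Finset.sum_insert ha, add_left_comm, Ring.add_choose_eq k (Commute.all _ _)]
      push_cast
      exact Finset.sum_congr rfl fun ij _ => by
        rw [← hfeq _ x hx, ← hgeq _ x hx]

end DegLEOn

theorem choose_add_prime_pow {p : ℕ} (hp : p.Prime) (v : ℕ) (y : ℤ) :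
    ((Ring.choose (y + (p ^ v : ℕ)) (p ^ v - 1) : ℤ) : ZMod p) =
      ((Ring.choose y (p ^ v - 1) : ℤ) : ZMod p) := by
  have hpos : 0 < p ^ v := pow_pos hp.pos v
  rw [Ring.add_choose_eq _ (Commute.all _ _), Int.cast_sum,
    Finset.sum_eq_single_of_mem (p ^ v - 1, 0) (by simp)]
  · simp
  · rintro ⟨a, b⟩ hab hne
    rw [Finset.HasAntidiagonal.mem_antidiagonal] at hab
    dsimp only at hab ⊢
    have hb : b ≠ 0 := by
      rintro rfl
      exact hne (by simpa using hab)
    have hdvd : p ∣ (p ^ v).choose b := hp.dvd_choose_pow hb (by omega)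
    rw [Ring.choose_natCast, Int.cast_mul, Int.cast_natCast,
      (ZMod.natCast_eq_zero_iff _ _).mpr hdvd, mul_zero]

theorem choose_ne_zero_iff_dvd {p : ℕ} (hp : p.Prime) (v : ℕ) (y : ℤ) :
    ((Ring.choose (y - 1) (p ^ v - 1) : ℤ) : ZMod p) ≠ 0 ↔ ((p ^ v : ℕ) : ℤ) ∣ y := by
  have : Fact p.Prime := ⟨hp⟩
  have hpos : 0 < p ^ v := pow_pos hp.pos v
  have hper : Function.Periodic
      (fun y : ℤ => ((Ring.choose (y - 1) (p ^ v - 1) : ℤ) : ZMod p)) ((p ^ v : ℕ) : ℤ) := by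
    intro y
    beta_reduce
    rw [add_sub_right_comm, choose_add_prime_pow hp]
  rw [Int.dvd_iff_emod_eq_zero]
  have hmod := hper.sub_zsmul_eq (x := y) (y / ((p ^ v : ℕ) : ℤ))
  rw [smul_eq_mul, mul_comm, ← Int.emod_def] at hmod
  rw [← hmod]
  have hlt := Int.emod_lt_of_pos y (Int.natCast_pos.mpr hpos)
  obtain ⟨m, hm⟩ := Int.eq_ofNat_of_zero_le (Int.emod_nonneg y (Int.natCast_pos.mpr hpos).ne')
  rw [hm] at hlt ⊢
  rcases m with _ | m
  · have h0 := hper 0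
    beta_reduce at h0
    rw [Nat.cast_zero, ← h0, zero_add, ← Nat.cast_pred hpos, Ring.choose_natCast]
    simp
  · have : m < p ^ v - 1 := by omega
    rw [Nat.cast_succ, add_sub_cancel_right, Ring.choose_natCast, Nat.choose_eq_zero_of_lt this]
    simp
    omega

theorem mBB_le_prod {n : ℕ} {a y : Fin n → ℕ} (hy : ∀ i, 1 ≤ y i ∧ y i ≤ a i) {N : ℤ}
    (hN : N ≤ ∑ i, (y i : ℤ)) : mBB n a N ≤ ∏ i, y i := by
  induction hk : ((∑ i, (y i : ℤ)) - N).toNat generalizing y with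
  | zero =>
    have hsum : ∑ i, (y i : ℤ) = N := by omega
    have hle : ∑ i, (y i : ℤ) ≤ ∑ i, (a i : ℤ) :=
      Finset.sum_le_sum fun i _ => by exact_mod_cast (hy i).2
    unfold mBB
    split_ifs with h1 h2
    · exact Finset.one_le_prod' fun i _ => (hy i).1
    · omega
    · exact Nat.sInf_le ⟨y, hy, hsum, rfl⟩
  | succ k ih =>
    by_cases hn : N < n
    · rw [mBB, if_pos hn]
      exact Finset.one_le_prod' fun i _ => (hy i).1
    · obtain ⟨i, -, hi⟩ : ∃ i ∈ Finset.univ, (1 : ℤ) < y i := by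
        refine Finset.exists_lt_of_sum_lt ?_
        simp only [Finset.sum_const, Finset.card_univ, Fintype.card_fin, nsmul_eq_mul, mul_one]
        omega
      have hle : Function.update y i (y i - 1) ≤ y := by
        simp
      have hsum : ∑ j, ((Function.update y i (y i - 1) j : ℕ) : ℤ) = ∑ j, (y j : ℤ) - 1 := by
        rw [← Finset.add_sum_erase _ _ (Finset.mem_univ i),
          ← Finset.add_sum_erase _ (fun j => (y j : ℤ)) (Finset.mem_univ i),
          Finset.sum_congr rfl fun j hj => by
            rw [Function.update_of_ne (Finset.ne_of_mem_erase hj)]]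
        simp only [Function.update_self]
        omega
      refine (ih (y := Function.update y i (y i - 1)) (fun j => ⟨?_, (hle j).trans (hy j).2⟩)
        (by omega) (by omega)).trans (Finset.prod_le_prod' fun j _ => hle j)
      rcases eq_or_ne j i with rfl | hj
      · rw [Function.update_self]
        omega
      · rw [Function.update_of_ne hj]
        exact (hy j).1

/-- Counting generalized `g`-sum subsequences in a `p`-group `G = ⊕_i ℤ/p^{v_i}ℤ`:
`N_{g,A}(x) = 0` or `N_{g,A}(x) ≥ m(#A₁,…,#A_n; #A₁+⋯+#A_n - ∑_i (p^{v_i}-1))`. -/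
theorem generalized_gsum_count
    (p : ℕ) (hp : p.Prime) (r : ℕ) (hr : 0 < r)
    (v : Fin r → ℕ) (hv : ∀ j, 0 < v j)
    (n : ℕ) (hn : 0 < n)
    (A : Fin n → Finset ℤ) (hA : ∀ i, (A i).Nonempty)
    (hAp : ∀ i, ∀ a ∈ A i, ∀ b ∈ A i, (p : ℤ) ∣ (a - b) → a = b)
    (x : Fin n → (∀ j : Fin r, ZMod (p ^ v j)))
    (g : ∀ j : Fin r, ZMod (p ^ v j)) :
    Set.ncard {a : Fin n → ℤ | (∀ i, a i ∈ A i) ∧ ∑ i, a i • x i = g} = 0 ∨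
      mBB n (fun i => (A i).card)
        ((∑ i, ((A i).card : ℤ)) - ∑ j, ((p : ℤ) ^ v j - 1)) ≤
        Set.ncard {a : Fin n → ℤ | (∀ i, a i ∈ A i) ∧ ∑ i, a i • x i = g} := by
  have : Fact p.Prime := ⟨hp⟩
  have hinj : ∀ i, Set.InjOn (Int.cast : ℤ → ZMod p) (A i) := fun i a ha b hb hab =>
    (hAp i b hb a ha ((ZMod.intCast_eq_intCast_iff_dvd_sub a b p).mp hab)).symm
  choose z hz using fun i j => ZMod.intCast_surjective (x i j)
  choose c hc using fun j => ZMod.intCast_surjective (g j)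
  choose F hF hFeq using fun j =>
    DegLEOn.choose_add_sum hinj (-c j - 1) (fun i => z i j) Finset.univ (p ^ v j - 1)
  have hprod := DegLE.prod Finset.univ fun j _ => hF j
  have hiff : ∀ a ∈ Fintype.piFinset A, ∏ j, F j a ≠ 0 ↔ ∑ i, a i • x i = g := by
    intro a ha
    rw [Finset.prod_ne_zero_iff, funext_iff]
    refine ⟨fun h j => ?_, fun h j _ => ?_⟩ <;> specialize h j
    all_goals
      have hj : F j a ≠ 0 ↔ (∑ i, a i • x i) j = g j := by
        have hlin : -c j - 1 + ∑ i, z i j * a i = (∑ i, z i j * a i - c j) - 1 := by ring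
        rw [← hFeq j a ha]
        beta_reduce
        rw [hlin, choose_ne_zero_iff_dvd hp,
          ← ZMod.intCast_eq_intCast_iff_dvd_sub, hc, eq_comm]
        simp [hz, mul_comm]
    · exact hj.mp (h (Finset.mem_univ j))
    · exact hj.mpr h
  have hset : {a : Fin n → ℤ | (∀ i, a i ∈ A i) ∧ ∑ i, a i • x i = g} =
      ({a ∈ Fintype.piFinset A | ∏ j, F j a ≠ 0} : Finset (Fin n → ℤ)) := by
    ext a
    simp only [Set.mem_ofPred_eq, Finset.coe_filter, ← Fintype.mem_piFinset]
    exact and_congr_right fun ha => (hiff a ha).symm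
  rw [hset, Set.ncard_coe_finset]
  refine or_iff_not_imp_left.mpr fun h0 => ?_
  obtain ⟨a, ha⟩ := Finset.card_ne_zero.mp h0
  obtain ⟨y, hy, hsum, hle⟩ := hprod.exists_prod_le_card_ne_zero A hinj
    ⟨a, Finset.mem_filter.mp ha⟩
  refine (mBB_le_prod hy ?_).trans hle
  have hcast : ((∑ j, (p ^ v j - 1) : ℕ) : ℤ) = ∑ j, ((p : ℤ) ^ v j - 1) := by
    rw [Nat.cast_sum]
    exact Finset.sum_congr rfl fun j _ => by
      rw [Nat.cast_pred (pow_pos hp.pos _), Nat.cast_pow]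
  rw [← hcast]
  have hsum' : ((∑ i, (A i).card : ℕ) : ℤ) ≤ ((∑ i, y i + ∑ j, (p ^ v j - 1) : ℕ) : ℤ) := by
    exact_mod_cast hsum
  rw [Nat.cast_add, Nat.cast_sum, Nat.cast_sum Finset.univ y] at hsum'
  omega
end

section
/- Let p be a prime and v, d, n positive integers; put q = p^v. Let X be a set and let F = (F_1,…,F_n) be a sequence of finite subsets of X of maximal degree at most d, i.e., every element of X belongs to at most d of the sets F_i. For g ∈ ℤ/p^vℤ let N_F(p^v, g) = #{J ⊆ {1,…,n} : #(∪_{i∈J} F_i) ≡ g (mod p^v)}. Then: a) N_F(p^v, g) = 0 or N_F(p^v, g) ≥ 2^{n − d(p^v−1)}; b) in particular N_F(p^v, 0) ≥ 2^{n − d(p^v−1)} (since the empty set J contributes). -/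
open Finset in
/-- The functions of `J` of multilinear degree at most `D`: the span of the indicators of
`Disjoint A J` over the sets `A` with at most `D` elements. -/
def disjointSpan (K : Type*) [Field K] (ι : Type*) [DecidableEq ι] (D : ℕ) :
    Submodule K (Finset ι → K) :=
  Submodule.span K ((fun A J : Finset ι => if Disjoint A J then (1 : K) else 0) '' {A | #A ≤ D})

section disjointSpan

open Finset

variable {K : Type*} [Field K] {ι : Type*} [DecidableEq ι]

theorem indicator_mem_disjointSpan {D : ℕ} {A : Finset ι} (hA : #A ≤ D) :
    (fun J => if Disjoint A J then (1 : K) else 0) ∈ disjointSpan K ι D :=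
  Submodule.subset_span ⟨A, hA, rfl⟩

theorem one_mem_disjointSpan (D : ℕ) : (1 : Finset ι → K) ∈ disjointSpan K ι D := by
  have h := indicator_mem_disjointSpan (K := K) (ι := ι) (D := D) (A := ∅) (by simp)
  simpa [Pi.one_def] using h

theorem disjointSpan_mono {D E : ℕ} (h : D ≤ E) : disjointSpan K ι D ≤ disjointSpan K ι E :=
  Submodule.span_mono (Set.image_mono fun _ hA => le_trans hA h)

theorem mul_mem_disjointSpan {D E : ℕ} {f g : Finset ι → K} (hf : f ∈ disjointSpan K ι D)
    (hg : g ∈ disjointSpan K ι E) : f * g ∈ disjointSpan K ι (D + E) := by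
  have h := Submodule.mul_mem_mul hf hg
  rw [disjointSpan, disjointSpan, Submodule.span_mul_span] at h
  refine Submodule.span_le.2 ?_ h
  rintro _ ⟨_, ⟨A, hA, rfl⟩, _, ⟨B, hB, rfl⟩, rfl⟩
  have hAB : #(A ∪ B) ≤ D + E := (card_union_le A B).trans (Nat.add_le_add hA hB)
  refine Set.mem_of_eq_of_mem ?_ (indicator_mem_disjointSpan (K := K) hAB)
  ext J
  by_cases h₁ : Disjoint A J <;> by_cases h₂ : Disjoint B J <;> simp [h₁, h₂]

theorem prod_mem_disjointSpan {α : Type*} {D : ℕ} (s : Finset α) (f : α → Finset ι → K)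
    (hf : ∀ x ∈ s, f x ∈ disjointSpan K ι D) : ∏ x ∈ s, f x ∈ disjointSpan K ι (D * #s) := by
  classical
  induction s using Finset.induction_on with
  | empty => simpa using one_mem_disjointSpan _
  | insert a s ha ih =>
    rw [prod_insert ha, card_insert_of_notMem ha, Nat.mul_succ, Nat.add_comm]
    exact mul_mem_disjointSpan (hf a (mem_insert_self a s))
      (ih fun x hx => hf x (mem_insert_of_mem hx))

/-- The alternating sum over the subsets of `A` extracts the coefficient of the top monomial. -/
theorem sum_powerset_neg_one_pow_mul_indicator (A B R : Finset ι) :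
    ∑ T ∈ A.powerset, (-1 : K) ^ #T * (if Disjoint B (R ∪ T) then 1 else 0) =
      if Disjoint B R ∧ A ⊆ B then 1 else 0 := by
  have h : ∑ T ∈ (A \ B).powerset, (-1 : K) ^ #T = if A ⊆ B then 1 else 0 := by
    have := congrArg (Int.cast : ℤ → K) (sum_powerset_neg_one_pow_card (x := A \ B))
    push_cast at this
    simpa [sdiff_eq_empty_iff_subset] using this
  by_cases hR : Disjoint B R
  · simp only [hR, true_and, disjoint_union_right, ← h, mul_ite, mul_one, mul_zero,
      ← sum_filter]
    refine sum_congr ?_ fun _ _ => rfl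
    ext T
    simp [subset_sdiff, disjoint_comm]
  · simp [hR, disjoint_union_right]

/-- A nonzero function of degree at most `D` on the subsets of `ι` has at least
`2 ^ (#ι - #A)` nonzeros for some `A` with at most `D` elements. -/
theorem exists_two_pow_le_card_ne_zero [Fintype ι] {D : ℕ} {f : Finset ι → K}
    (hf : f ∈ disjointSpan K ι D) (h0 : f ≠ 0) :
    ∃ A : Finset ι, #A ≤ D ∧ 2 ^ (Fintype.card ι - #A) ≤ {J | f J ≠ 0}.ncard := by
  classical
  obtain ⟨c, hc, rfl⟩ := (Finsupp.mem_span_image_iff_linearCombination K).1 hf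
  have hne : c.support.Nonempty := by
    rw [Finsupp.support_nonempty_iff]
    rintro rfl
    simp at h0
  obtain ⟨A, hA⟩ := c.support.exists_maximal hne
  refine ⟨A, hc hA.prop, ?_⟩
  set f := Finsupp.linearCombination K
    (fun A J : Finset ι => if Disjoint A J then (1 : K) else 0) c with hfdef
  have hfJ (J : Finset ι) : f J = ∑ B ∈ c.support, c B * (if Disjoint B J then 1 else 0) := by
    simp [hfdef, Finsupp.linearCombination_apply, Finsupp.sum]
  have hex (R : Finset ι) (hR : R ∈ Aᶜ.powerset) : ∃ T ⊆ A, f (R ∪ T) ≠ 0 := by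
    by_contra! hz
    have hAR : Disjoint A R := (disjoint_compl_right).mono_right (mem_powerset.1 hR)
    have hsum : ∑ T ∈ A.powerset, (-1 : K) ^ #T * f (R ∪ T) = c A := by
      simp only [hfJ, mul_sum, mul_left_comm _ (c _) _]
      rw [sum_comm]
      simp only [← mul_sum, sum_powerset_neg_one_pow_mul_indicator]
      rw [sum_eq_single_of_mem A hA.prop]
      · simp [hAR]
      · intro B hB hBA
        rw [if_neg, mul_zero]
        rintro ⟨-, hAB⟩
        exact hBA (subset_antisymm (hA.le_of_ge hB hAB) hAB)
    refine Finsupp.mem_support_iff.1 hA.prop (hsum ▸ sum_eq_zero fun T hT => ?_)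
    rw [hz T (mem_powerset.1 hT), mul_zero]
  choose! T hT hfT using hex
  rw [← card_compl, ← card_powerset, ← Set.ncard_coe_finset]
  refine Set.ncard_le_ncard_of_injOn (fun R => R ∪ T R) (fun R hR => hfT R hR) ?_
    (Set.toFinite _)
  have key (R : Finset ι) (hR : R ∈ Aᶜ.powerset) : (R ∪ T R) \ A = R := by
    rw [union_sdiff_distrib, sdiff_eq_empty_iff_subset.2 (hT R hR), union_empty,
      sdiff_eq_self_of_disjoint]
    exact (disjoint_compl_left).mono_left (mem_powerset.1 hR)
  intro R hR S hS h
  rw [← key R hR, ← key S hS]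
  exact congrArg (· \ A) h

theorem choose_card_biUnion_mem_disjointSpan [Fintype ι] {X : Type*} [DecidableEq X]
    (F : ι → Finset X) {d : ℕ} (hdeg : ∀ x, #{i | x ∈ F i} ≤ d) (k : ℕ) :
    (fun J : Finset ι => ((#(J.biUnion F)).choose k : K)) ∈ disjointSpan K ι (d * k) := by
  have hcover (x : X) :
      (fun J : Finset ι => if x ∈ J.biUnion F then (1 : K) else 0) ∈ disjointSpan K ι d := by
    convert Submodule.sub_mem _ (one_mem_disjointSpan d)
      (indicator_mem_disjointSpan (K := K) (hdeg x)) using 1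
    ext J
    by_cases h : x ∈ J.biUnion F
    · have : ¬ Disjoint ({i | x ∈ F i} : Finset ι) J := by
        obtain ⟨i, hi, hx⟩ := mem_biUnion.1 h
        exact not_disjoint_iff.2 ⟨i, by simpa using hx, hi⟩
      simp only [h, this, if_true, if_false, Pi.sub_apply, Pi.one_apply, sub_zero]
    · have : Disjoint ({i | x ∈ F i} : Finset ι) J := by
        refine disjoint_left.2 fun i hi hJ => h (mem_biUnion.2 ⟨i, hJ, by simpa using hi⟩)
      simp only [h, this, if_true, if_false, Pi.sub_apply, Pi.one_apply, sub_self]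
  have hsum : (fun J : Finset ι => ((#(J.biUnion F)).choose k : K)) =
      ∑ S ∈ powersetCard k (univ.biUnion F), ∏ x ∈ S,
        fun J : Finset ι => if x ∈ J.biUnion F then (1 : K) else 0 := by
    ext J
    simp only [Finset.sum_apply, Finset.prod_apply, prod_boole, sum_boole]
    rw [← card_powersetCard]
    congr 2
    ext S
    simp only [mem_filter, mem_powersetCard]
    have hJ : J.biUnion F ⊆ univ.biUnion F := biUnion_subset_biUnion_of_subset_left F (subset_univ J)
    exact ⟨fun h => ⟨⟨h.1.trans hJ, h.2⟩, fun x hx => h.1 hx⟩, fun h => ⟨h.2, h.1.2⟩⟩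
  rw [hsum]
  refine Submodule.sum_mem _ fun S hS => ?_
  rw [← (mem_powersetCard.1 hS).2]
  exact prod_mem_disjointSpan S _ fun x _ => hcover x

theorem choose_card_biUnion_add_mem_disjointSpan [Fintype ι] {X : Type*} [DecidableEq X]
    (F : ι → Finset X) {d : ℕ} (hdeg : ∀ x, #{i | x ∈ F i} ≤ d) (c k : ℕ) :
    (fun J : Finset ι => ((#(J.biUnion F) + c).choose k : K)) ∈ disjointSpan K ι (d * k) := by
  have hsum : (fun J : Finset ι => ((#(J.biUnion F) + c).choose k : K)) =
      ∑ ij ∈ antidiagonal k, (c.choose ij.2 : K) •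
        fun J : Finset ι => ((#(J.biUnion F)).choose ij.1 : K) := by
    ext J
    simp [Nat.add_choose_eq, mul_comm]
  rw [hsum]
  refine Submodule.sum_mem _ fun ij hij => Submodule.smul_mem _ _ ?_
  have : ij.1 ≤ k := (mem_antidiagonal.1 hij) ▸ Nat.le_add_right _ _
  exact disjointSpan_mono (Nat.mul_le_mul_left d this)
    (choose_card_biUnion_mem_disjointSpan F hdeg ij.1)

end disjointSpan

theorem Nat.Prime.dvd_choose_pow_sub_one_iff {p : ℕ} (hp : p.Prime) (v N : ℕ) :
    p ∣ N.choose (p ^ v - 1) ↔ ¬ p ^ v ∣ N + 1 := by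
  induction v generalizing N with
  | zero => simpa using hp.one_lt.ne'
  | succ v ih =>
    have := Fact.mk hp
    have hp0 := hp.pos
    have hq : 0 < p ^ v := pow_pos hp0 v
    have hsplit : p ^ (v + 1) - 1 = (p - 1) + p * (p ^ v - 1) := by
      rw [pow_succ', Nat.mul_sub, mul_one]
      have : p * 1 ≤ p * p ^ v := Nat.mul_le_mul_left p hq
      omega
    have hmod : (p ^ (v + 1) - 1) % p = p - 1 := by
      rw [hsplit, Nat.add_mul_mod_self_left, Nat.mod_eq_of_lt (by omega)]
    have hdiv : (p ^ (v + 1) - 1) / p = p ^ v - 1 := by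
      rw [hsplit, Nat.add_mul_div_left _ _ hp0, Nat.div_eq_of_lt (by omega), zero_add]
    have hN := Nat.mod_add_div N p
    have hlt := Nat.mod_lt N hp0
    rw [(Choose.choose_modEq_choose_mod_mul_choose_div_nat (p := p)).dvd_iff dvd_rfl, hmod, hdiv,
      hp.dvd_mul, ih]
    by_cases h : N % p = p - 1
    · have hN1 : N + 1 = p * (N / p + 1) := by rw [Nat.mul_add]; omega
      rw [h, Nat.choose_self, hN1, pow_succ', Nat.mul_dvd_mul_iff_left hp0]
      simp [hp.one_lt.ne']
    · rw [Nat.choose_eq_zero_of_lt (by omega)]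
      simp only [dvd_zero, true_or, true_iff]
      intro hdvd
      obtain ⟨m, hm⟩ := (dvd_pow_self p v.succ_ne_zero).trans hdvd
      apply h
      have : N = (p - 1) + p * (m - 1) := by
        rw [Nat.mul_sub, mul_one]
        have : p * 1 ≤ p * m := Nat.mul_le_mul_left p (by rcases m with _ | m <;> omega)
        omega
      rw [this, Nat.add_mul_mod_self_left, Nat.mod_eq_of_lt (by omega)]


/-- Counting sub-(set systems) with union cardinality congruent to `g` modulo `q = p^v`:
for a set system `F = (F₁,…,F_n)` of maximal degree at most `d`,
a) `N_F(p^v, g) = 0` or `N_F(p^v, g) ≥ 2^(n - d(p^v-1))`; and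
b) `N_F(p^v, 0) ≥ 2^(n - d(p^v-1))`. -/
theorem set_system_union_count
    (p : ℕ) (hp : p.Prime) (v d n : ℕ) (hv : 0 < v) (hd : 0 < d) (hn : 0 < n)
    (X : Type*) [DecidableEq X] (F : Fin n → Finset X)
    (hdeg : ∀ x : X, (Finset.univ.filter fun i => x ∈ F i).card ≤ d) :
    (∀ g : ZMod (p ^ v),
      Set.ncard {J : Finset (Fin n) | ((J.biUnion F).card : ZMod (p ^ v)) = g} = 0 ∨
      (2 : ℝ) ^ ((n : ℤ) - (d : ℤ) * ((p : ℤ) ^ v - 1)) ≤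
        (Set.ncard {J : Finset (Fin n) | ((J.biUnion F).card : ZMod (p ^ v)) = g} : ℝ)) ∧
    (2 : ℝ) ^ ((n : ℤ) - (d : ℤ) * ((p : ℤ) ^ v - 1)) ≤
      (Set.ncard {J : Finset (Fin n) | ((J.biUnion F).card : ZMod (p ^ v)) = 0} : ℝ) := by
  have := Fact.mk hp
  have hq : 0 < p ^ v := pow_pos hp.pos v
  have : NeZero (p ^ v) := ⟨hq.ne'⟩
  have main (g : ZMod (p ^ v)) (J₀ : Finset (Fin n))
      (hJ₀ : ((J₀.biUnion F).card : ZMod (p ^ v)) = g) :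
      (2 : ℝ) ^ ((n : ℤ) - (d : ℤ) * ((p : ℤ) ^ v - 1)) ≤
        (Set.ncard {J : Finset (Fin n) | ((J.biUnion F).card : ZMod (p ^ v)) = g} : ℝ) := by
    set f : Finset (Fin n) → ZMod p := fun J =>
      (((J.biUnion F).card + (-g - 1).val).choose (p ^ v - 1) : ZMod p) with hf
    have hiff (J : Finset (Fin n)) :
        f J ≠ 0 ↔ ((J.biUnion F).card : ZMod (p ^ v)) = g := by
      rw [hf, Ne, ZMod.natCast_eq_zero_iff, hp.dvd_choose_pow_sub_one_iff, not_not,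
        ← ZMod.natCast_eq_zero_iff, ← sub_eq_zero (b := g)]
      push_cast
      rw [ZMod.natCast_zmod_val]
      ring_nf
    obtain ⟨A, hA, hcard⟩ := exists_two_pow_le_card_ne_zero
      (choose_card_biUnion_add_mem_disjointSpan F hdeg (-g - 1).val (p ^ v - 1))
      (fun h => (hiff J₀).2 hJ₀ (congrFun h J₀))
    simp only [Fintype.card_fin] at hcard
    change _ ≤ {J | f J ≠ 0}.ncard at hcard
    simp only [hiff] at hcard
    have hAn : A.card ≤ n := by simpa using A.card_le_univ
    calc (2 : ℝ) ^ ((n : ℤ) - (d : ℤ) * ((p : ℤ) ^ v - 1))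
        ≤ (2 : ℝ) ^ ((n - A.card : ℕ) : ℤ) := by
          refine zpow_le_zpow_right₀ one_le_two ?_
          have hA' : (A.card : ℤ) ≤ ((d * (p ^ v - 1) : ℕ) : ℤ) := by exact_mod_cast hA
          push_cast [Nat.cast_sub hAn, Nat.cast_sub (Nat.one_le_iff_ne_zero.2 hq.ne')] at hA' ⊢
          linarith
      _ ≤ _ := by
          rw [zpow_natCast]
          exact_mod_cast hcard
  refine ⟨fun g => or_iff_not_imp_left.2 fun h => ?_, main 0 ∅ (by simp)⟩
  obtain ⟨J₀, hJ₀⟩ := Set.nonempty_of_ncard_ne_zero h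
  exact main g J₀ hJ₀
end

section
/- Let p be a prime and v, d positive integers; put q = p^v. Then: (i) for every set X and every set system F = (F_1,…,F_n) of finite subsets of X with maximal degree at most d and length n ≥ d(q−1)+1, there exists a nonempty subset J ⊆ {1,…,n} such that q divides #(∪_{i∈J} F_i); and (ii) there exists a set X and a set system of length d(q−1) and maximal degree at most d such that no nonempty J ⊆ {1,…,d(q−1)} satisfies q | #(∪_{i∈J} F_i). Hence the least n such that every set system of length n and maximal degree at most d admits such a nonempty J equals d(q−1)+1. -/
/-- A length-`n` set system of maximal degree at most `d` always admits a nonempty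
subfamily whose union has cardinality divisible by `q`. -/
def AdmitsZeroUnion (q d n : ℕ) : Prop :=
  ∀ (X : Type) [DecidableEq X] (F : Fin n → Finset X),
    (∀ x : X, (Finset.univ.filter fun i => x ∈ F i).card ≤ d) →
    ∃ J : Finset (Fin n), J.Nonempty ∧ q ∣ (J.biUnion F).card

/-- Alternating sums over the subsets of `ι` of a function that ignores some index vanish. -/
theorem sum_neg_one_pow_card_mul_eq_zero {ι : Type*} [Fintype ι] [DecidableEq ι] (i : ι)
    (f : Finset ι → ℤ) (hf : ∀ J, i ∉ J → f (insert i J) = f J) :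
    ∑ J : Finset ι, (-1) ^ J.card * f J = 0 := by
  rw [← Finset.powerset_univ, ← Finset.insert_erase (Finset.mem_univ i),
    Finset.sum_powerset_insert (Finset.notMem_erase _ _), ← Finset.sum_add_distrib]
  refine Finset.sum_eq_zero fun J hJ => ?_
  have hi : i ∉ J := fun h => Finset.notMem_erase _ _ (Finset.mem_powerset.1 hJ h)
  rw [hf J hi, Finset.card_insert_of_notMem hi, pow_succ]
  ring

/-- The alternating sum of the number of `k`-subsets of the unions of a set system of maximal
degree at most `d` vanishes as soon as the system has more than `d * k` members. -/
theorem sum_neg_one_pow_card_mul_choose_card_biUnion {ι X : Type*} [Fintype ι] [DecidableEq ι]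
    [DecidableEq X] {d : ℕ} (F : ι → Finset X)
    (hF : ∀ x : X, (Finset.univ.filter fun i => x ∈ F i).card ≤ d) {k : ℕ}
    (hk : d * k < Fintype.card ι) :
    ∑ J : Finset ι, (-1) ^ J.card * ((J.biUnion F).card.choose k : ℤ) = 0 := by
  have hcount (J : Finset ι) : ((J.biUnion F).card.choose k : ℤ) =
      ∑ S ∈ (Finset.univ.biUnion F).powersetCard k, if S ⊆ J.biUnion F then 1 else 0 := by
    rw [← Finset.card_powersetCard, Finset.sum_boole]
    congr 2
    ext S
    simp only [Finset.mem_powersetCard, Finset.mem_filter]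
    have := Finset.biUnion_subset_biUnion_of_subset_left F (Finset.subset_univ J)
    exact ⟨fun h => ⟨⟨h.1.trans this, h.2⟩, h.1⟩, fun h => ⟨h.2, h.1.2⟩⟩
  simp_rw [hcount, Finset.mul_sum]
  rw [Finset.sum_comm]
  refine Finset.sum_eq_zero fun S hS => ?_
  have hSk := (Finset.mem_powersetCard.1 hS).2
  obtain ⟨i, -, hi⟩ : ∃ i ∈ Finset.univ,
      i ∉ S.biUnion fun x => Finset.univ.filter fun i => x ∈ F i := by
    apply Finset.exists_mem_notMem_of_card_lt_card
    calc _ ≤ S.card * d := Finset.card_biUnion_le_card_mul _ _ _ fun x _ => hF x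
      _ < _ := by rwa [hSk, mul_comm, Finset.card_univ]
  refine sum_neg_one_pow_card_mul_eq_zero i _ fun J _ => ?_
  have hdisj : Disjoint S (F i) := by
    rw [Finset.disjoint_left]
    intro x hx hxi
    exact hi (Finset.mem_biUnion.2 ⟨x, hx, by simpa using hxi⟩)
  congr 1
  rw [Finset.biUnion_insert, eq_iff_iff]
  exact ⟨fun h => hdisj.left_le_of_le_sup_left h, fun h => h.trans Finset.subset_union_right⟩

theorem Nat.Prime.dvd_choose_add_pow_sub_one {p : ℕ} (hp : p.Prime) {v h : ℕ}
    (hh : ¬ p ^ v ∣ h) : p ∣ (h + (p ^ v - 1)).choose (p ^ v - 1) := by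
  by_contra hc
  refine hh (((hp.coprime_iff_not_dvd.2 hc).pow_left v).dvd_of_dvd_mul_left ?_)
  have := Nat.choose_succ_right_eq (h + (p ^ v - 1)) (p ^ v - 1)
  rw [Nat.sub_add_cancel (Nat.one_le_pow _ _ hp.pos), Nat.add_sub_cancel] at this
  exact this ▸ Dvd.intro_left _ rfl

theorem admitsZeroUnion_prime_pow {p : ℕ} (hp : p.Prime) (v d n : ℕ)
    (hn : d * (p ^ v - 1) + 1 ≤ n) : AdmitsZeroUnion (p ^ v) d n := by
  intro X _ F hF
  by_contra! hJ
  set m := p ^ v - 1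
  have hsum : ∑ J : Finset (Fin n),
      (-1) ^ J.card * (((J.biUnion F).card + m).choose m : ℤ) = 0 := by
    simp_rw [Nat.add_choose_eq, Nat.cast_sum, Nat.cast_mul, Finset.mul_sum]
    rw [Finset.sum_comm]
    refine Finset.sum_eq_zero fun a ha => ?_
    have ha' : a.1 ≤ m :=
      (Nat.le_add_right _ _).trans_eq (Finset.HasAntidiagonal.mem_antidiagonal.1 ha)
    simp_rw [← mul_assoc]
    rw [← Finset.sum_mul, sum_neg_one_pow_card_mul_choose_card_biUnion F hF, zero_mul]
    rw [Fintype.card_fin]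
    exact (Nat.mul_le_mul_left d ha').trans_lt hn
  rw [← Finset.add_sum_erase _ _ (Finset.mem_univ ∅)] at hsum
  have hdvd : (p : ℤ) ∣ ∑ J ∈ Finset.univ.erase (∅ : Finset (Fin n)),
      (-1) ^ J.card * (((J.biUnion F).card + m).choose m : ℤ) := by
    refine Finset.dvd_sum fun J hJ' => Dvd.dvd.mul_left (Int.natCast_dvd_natCast.2 ?_) _
    exact hp.dvd_choose_add_pow_sub_one
      (hJ J (Finset.nonempty_iff_ne_empty.2 (Finset.ne_of_mem_erase hJ')))
  have hone := (dvd_add_left hdvd).1 (hsum ▸ dvd_zero (p : ℤ))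
  simp only [Finset.card_empty, pow_zero, Finset.biUnion_empty, zero_add, Nat.choose_self,
    Nat.cast_one, mul_one] at hone
  exact hp.one_lt.ne' (Nat.dvd_one.1 (by exact_mod_cast hone))

theorem exists_setSystem_not_dvd_card_biUnion (d q : ℕ) (hq : 0 < q) :
    ∃ (X : Type) (_ : DecidableEq X) (F : Fin (d * (q - 1)) → Finset X),
      (∀ x : X, (Finset.univ.filter fun i => x ∈ F i).card ≤ d) ∧
      ∀ J : Finset (Fin (d * (q - 1))), J.Nonempty → ¬ (q ∣ (J.biUnion F).card) := by
  refine ⟨Fin (q - 1), inferInstance, fun i => {i.modNat}, fun x => ?_, fun J hJ hdvd => ?_⟩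
  · refine (Finset.card_le_card_of_injOn Fin.divNat (t := Finset.univ) (by simp) ?_).trans
      (by simp)
    intro i hi j hj hij
    simp only [Finset.mem_singleton, Finset.coe_filter, Finset.mem_univ, true_and,
      Set.mem_ofPred_eq] at hi hj
    exact finProdFinEquiv.symm.injective (Prod.ext hij (hi.symm.trans hj))
  · have hle : _ ≤ q - 1 :=
      (Finset.card_le_univ (J.biUnion fun i => {i.modNat})).trans_eq (Fintype.card_fin _)
    have hpos : 0 < (J.biUnion fun i => {i.modNat}).card :=
      Finset.card_pos.2 (hJ.biUnion fun _ _ => Finset.singleton_nonempty _)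
    have := Nat.le_of_dvd hpos hdvd
    omega

theorem AdmitsZeroUnion.mono {q d m n : ℕ} (hmn : m ≤ n) (h : AdmitsZeroUnion q d m) :
    AdmitsZeroUnion q d n := by
  intro X _ F hF
  obtain ⟨J, hJ, hdvd⟩ := h X (F ∘ Fin.castLEEmb hmn) fun x => by
    refine le_trans ?_ (hF x)
    refine Finset.card_le_card_of_injOn (Fin.castLEEmb hmn) ?_
      (Fin.castLEEmb hmn).injective.injOn
    intro i hi
    simpa using (Finset.mem_filter.1 hi).2
  refine ⟨J.map (Fin.castLEEmb hmn), hJ.map, ?_⟩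
  rwa [Finset.map_eq_image, Finset.image_biUnion]

/-- **AKLMRS Theorem**: for a prime power `q = p^v`, (i) every set system of length
`n ≥ d(q-1)+1` and maximal degree at most `d` has a nonempty subfamily whose union has
cardinality divisible by `q`; (ii) there is a set system of length `d(q-1)` and maximal
degree at most `d` with no such nonempty subfamily; hence the least such length
`f_d(q)` equals `d(q-1)+1`. -/
theorem aklmrs_set_systems
    (p : ℕ) (hp : p.Prime) (v d : ℕ) (hv : 0 < v) (hd : 0 < d) :
    (∀ n : ℕ, d * (p ^ v - 1) + 1 ≤ n → AdmitsZeroUnion (p ^ v) d n) ∧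
    (∃ (X : Type) (_ : DecidableEq X) (F : Fin (d * (p ^ v - 1)) → Finset X),
      (∀ x : X, (Finset.univ.filter fun i => x ∈ F i).card ≤ d) ∧
      ∀ J : Finset (Fin (d * (p ^ v - 1))), J.Nonempty → ¬ (p ^ v ∣ (J.biUnion F).card)) ∧
    IsLeast {n : ℕ | 0 < n ∧ AdmitsZeroUnion (p ^ v) d n} (d * (p ^ v - 1) + 1) := by
  have hex := exists_setSystem_not_dvd_card_biUnion d (p ^ v) (Nat.pow_pos hp.pos)
  refine ⟨admitsZeroUnion_prime_pow hp v d, hex,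
    ⟨Nat.succ_pos _, admitsZeroUnion_prime_pow hp v d _ le_rfl⟩, fun n hn => ?_⟩
  by_contra! hlt
  obtain ⟨X, _, F, hF, hJ⟩ := hex
  obtain ⟨J, hne, hdvd⟩ := hn.2.mono (Nat.lt_succ_iff.1 hlt) X F hF
  exact hJ J hne hdvd
end
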